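/- Assume H(A), H(B), H(J), H(f), H(u₀) and (H_s), and fix z ∈ V and g ∈ V*. Then the Clarke subdifferential of L(w) = ½⟨Aw,w⟩ + ⟨Bz − g, w⟩ + J(γz, γw) is strongly monotone: for all w¹, w² ∈ V and all η₁ ∈ ∂L(w¹), η₂ ∈ ∂L(w²) one has ⟨η₁ − η₂, w¹ − w²⟩ ≥ (m_A − m_{J1} c_γ²) ‖w¹ − w²‖_V², and consequently L is strictly convex. -/

import Mathlib

open Filter MeasureTheory Set

noncomputable def clarkeDeriv {Y : Type*} [NormedAddCommGroup Y] [NormedSpace ℝ Y]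
    (φ : Y → ℝ) (y z : Y) : ℝ :=
  Filter.limsup (fun p : Y × ℝ => (φ (p.1 + p.2 • z) - φ p.1) / p.2)
    ((nhds y) ×ˢ (nhdsWithin 0 (Set.Ioi 0)))

def clarkeSubdiff {Y : Type*} [NormedAddCommGroup Y] [NormedSpace ℝ Y]
    (φ : Y → ℝ) (y : Y) : Set (Y →L[ℝ] ℝ) :=
  {ξ | ∀ z, ξ z ≤ clarkeDeriv φ y z}

/-- The functional `L(w) = ½⟨Aw,w⟩ + ⟨Bz − g, w⟩ + J(γz, γw)`. -/
noncomputable def Lfun {V X : Type*} [NormedAddCommGroup V] [NormedSpace ℝ V]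
    [NormedAddCommGroup X] [NormedSpace ℝ X]
    (γ : V →L[ℝ] X) (A : V →L[ℝ] V →L[ℝ] ℝ) (B : V → V →L[ℝ] ℝ)
    (J : X → X → ℝ) (z : V) (g : V →L[ℝ] ℝ) (w : V) : ℝ :=
  (1 / 2) * A w w + (B z - g) w + J (γ z) (γ w)

theorem tendsto_fst_add_snd_smul {Y : Type*} [NormedAddCommGroup Y] [NormedSpace ℝ Y] (y z : Y) :
    Tendsto (fun p : Y × ℝ => p.1 + p.2 • z) (nhds y ×ˢ nhdsWithin 0 (Ioi 0)) (nhds y) := by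
  have h : Tendsto (fun p : Y × ℝ => p.1 + p.2 • z) (nhds (y, (0 : ℝ))) (nhds (y + (0 : ℝ) • z)) :=
    Continuous.tendsto (by fun_prop) _
  rw [zero_smul, add_zero, nhds_prod_eq] at h
  exact h.mono_left (prod_mono le_rfl nhdsWithin_le_nhds)

theorem eventually_snd_pos {Y : Type*} [TopologicalSpace Y] (y : Y) :
    ∀ᶠ p : Y × ℝ in nhds y ×ˢ nhdsWithin 0 (Ioi 0), 0 < p.2 :=
  tendsto_snd.eventually self_mem_nhdsWithin

theorem LocallyLipschitz.eventually_abs_quotient_le {Y : Type*} [NormedAddCommGroup Y]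
    [NormedSpace ℝ Y] {φ : Y → ℝ} (hφ : LocallyLipschitz φ) (y z : Y) :
    ∃ C : ℝ, ∀ᶠ p : Y × ℝ in nhds y ×ˢ nhdsWithin 0 (Ioi 0),
      |(φ (p.1 + p.2 • z) - φ p.1) / p.2| ≤ C := by
  obtain ⟨K, U, hU, hK⟩ := hφ y
  refine ⟨K * ‖z‖, ?_⟩
  filter_upwards [tendsto_fst_add_snd_smul y z hU, tendsto_fst hU, eventually_snd_pos y]
    with p hp₁ hp₂ hp₃
  have h := hK.dist_le_mul _ hp₁ _ hp₂
  rw [Real.dist_eq, dist_eq_norm, add_sub_cancel_left, norm_smul, Real.norm_of_nonneg hp₃.le] at h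
  rw [abs_div, abs_of_pos hp₃, div_le_iff₀ hp₃]
  linarith

theorem LocallyLipschitz.isBoundedUnder_quotient {Y : Type*} [NormedAddCommGroup Y]
    [NormedSpace ℝ Y] {φ : Y → ℝ} (hφ : LocallyLipschitz φ) (y z : Y) :
    IsBoundedUnder (· ≤ ·) (nhds y ×ˢ nhdsWithin 0 (Ioi 0))
      (fun p : Y × ℝ => (φ (p.1 + p.2 • z) - φ p.1) / p.2) := by
  obtain ⟨C, hC⟩ := hφ.eventually_abs_quotient_le y z
  exact isBoundedUnder_of_eventually_le (hC.mono fun _ h => (abs_le.1 h).2)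

theorem LocallyLipschitz.isCoboundedUnder_quotient {Y : Type*} [NormedAddCommGroup Y]
    [NormedSpace ℝ Y] {φ : Y → ℝ} (hφ : LocallyLipschitz φ) (y z : Y) :
    IsCoboundedUnder (· ≤ ·) (nhds y ×ˢ nhdsWithin 0 (Ioi 0))
      (fun p : Y × ℝ => (φ (p.1 + p.2 • z) - φ p.1) / p.2) := by
  obtain ⟨C, hC⟩ := hφ.eventually_abs_quotient_le y z
  exact (isBoundedUnder_of_eventually_ge
    (hC.mono fun _ h => (abs_le.1 h).1)).isCoboundedUnder_le

theorem LocallyLipschitz.le_clarkeDeriv {Y : Type*} [NormedAddCommGroup Y] [NormedSpace ℝ Y]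
    {φ : Y → ℝ} (hφ : LocallyLipschitz φ) {y z : Y} {c : ℝ} {p : ℝ → Y}
    (hp : Tendsto p (nhdsWithin 0 (Ioi 0)) (nhds y))
    (h : ∀ᶠ r in nhdsWithin (0 : ℝ) (Ioi 0), c * r ≤ φ (p r + r • z) - φ (p r)) :
    c ≤ clarkeDeriv φ y z := by
  refine le_limsup_of_frequently_le ?_ (hφ.isBoundedUnder_quotient y z)
  refine (hp.prodMk tendsto_id).frequently (Eventually.frequently ?_)
  filter_upwards [h, self_mem_nhdsWithin] with r hr hr0
  exact (le_div_iff₀ hr0).2 hr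

theorem clarkeDeriv_add_comp_le {V X : Type*} [NormedAddCommGroup V] [NormedSpace ℝ V]
    [NormedAddCommGroup X] [NormedSpace ℝ X] {ψ : X → ℝ} (hψ : LocallyLipschitz ψ)
    (γ : V →L[ℝ] X) {q : V → ℝ} (hq : LocallyLipschitz fun v => q v + ψ (γ v)) {w d : V} {a : ℝ}
    (ha : Tendsto (fun p : V × ℝ => (q (p.1 + p.2 • d) - q p.1) / p.2)
      (nhds w ×ˢ nhdsWithin 0 (Ioi 0)) (nhds a)) :
    clarkeDeriv (fun v => q v + ψ (γ v)) w d ≤ a + clarkeDeriv ψ (γ w) (γ d) := by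
  refine le_of_forall_pos_le_add fun ε hε => ?_
  have h₁ : ∀ᶠ p : X × ℝ in nhds (γ w) ×ˢ nhdsWithin 0 (Ioi 0),
      (ψ (p.1 + p.2 • γ d) - ψ p.1) / p.2 < clarkeDeriv ψ (γ w) (γ d) + ε / 2 :=
    eventually_lt_of_limsup_lt (lt_add_of_pos_right _ (half_pos hε))
      (hψ.isBoundedUnder_quotient _ _)
  have h₂ : Tendsto (fun p : V × ℝ => (γ p.1, p.2)) (nhds w ×ˢ nhdsWithin 0 (Ioi 0))
      (nhds (γ w) ×ˢ nhdsWithin 0 (Ioi 0)) :=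
    ((γ.continuous.tendsto w).comp tendsto_fst).prodMk tendsto_snd
  refine limsup_le_of_le (hq.isCoboundedUnder_quotient w d) ?_
  filter_upwards [h₂.eventually h₁, ha.eventually_lt_const (lt_add_of_pos_right a (half_pos hε))]
    with p hp₁ hp₂
  rw [map_add, map_smul, add_sub_add_comm, add_div]
  linarith

theorem strictConvexOn_of_clarkeDeriv_add_neg {Y : Type*} [NormedAddCommGroup Y] [NormedSpace ℝ Y]
    {φ : Y → ℝ} (hφ : LocallyLipschitz φ)
    (h : ∀ x y, x ≠ y → clarkeDeriv φ x (y - x) + clarkeDeriv φ y (x - y) < 0) :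
    StrictConvexOn ℝ univ φ := by
  refine ⟨convex_univ, fun x _ y _ hxy a b ha hb hab => ?_⟩
  by_contra! hcon
  obtain ⟨d, rfl⟩ : ∃ d, y = x + d := ⟨y - x, by abel⟩
  have hd : d ≠ 0 := by rintro rfl; simp at hxy
  obtain rfl : a = 1 - b := by linarith
  have hpt : (1 - b) • x + b • (x + d) = x + b • d := by module
  rw [hpt, smul_eq_mul, smul_eq_mul] at hcon
  set α := φ (x + d) - φ x with hα
  let G : ℝ → ℝ := fun t => φ (x + t • d) - t * α
  have hG : Continuous G := by
    have := hφ.continuous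
    fun_prop
  have hG0 : G 0 = φ x := by simp [G]
  have hG1 : G 1 = φ x := by simp [G, hα]
  have hGb : φ x ≤ G b := by simp only [G, hα]; linarith
  obtain ⟨τ, hτ, hmax⟩ : ∃ τ ∈ Ioo (0 : ℝ) 1, ∀ t ∈ Icc (0 : ℝ) 1, G t ≤ G τ := by
    obtain ⟨τ, hτ, hm⟩ := isCompact_Icc.exists_isMaxOn (nonempty_Icc.2 zero_le_one) hG.continuousOn
    by_cases hi : τ ∈ Ioo (0 : ℝ) 1
    · exact ⟨τ, hi, hm⟩
    · refine ⟨b, ⟨hb, by linarith⟩, fun t ht => (hm ht).trans (le_trans (le_of_eq ?_) hGb)⟩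
      rcases hτ.1.eq_or_lt with h0 | h0
      · rw [← h0, hG0]
      · rcases hτ.2.eq_or_lt with h1 | h1
        · rw [h1, hG1]
        · exact absurd ⟨h0, h1⟩ hi
  obtain ⟨s, hs, hmin⟩ : ∃ s ∈ Ioc τ 1, ∀ t ∈ Icc τ 1, G s ≤ G t := by
    obtain ⟨s, hs, hm⟩ := isCompact_Icc.exists_isMinOn (nonempty_Icc.2 hτ.2.le) hG.continuousOn
    rcases hs.1.eq_or_lt with h0 | h0
    · refine ⟨1, ⟨hτ.2, le_rfl⟩, fun t ht => (hmax 1 (by simp)).trans ?_⟩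
      rw [h0]
      exact hm ht
    · exact ⟨s, ⟨h0, hs.2⟩, hm⟩
  have hσ : 0 < s - τ := sub_pos.2 hs.1
  have hlim : Tendsto (fun r : ℝ => r * (s - τ)) (nhdsWithin 0 (Ioi 0)) (nhds 0) := by
    have : Tendsto (fun r : ℝ => r * (s - τ)) (nhds 0) (nhds (0 * (s - τ))) :=
      Continuous.tendsto (by fun_prop) _
    rw [zero_mul] at this
    exact this.mono_left nhdsWithin_le_nhds
  have h₁ : α * (s - τ) ≤ clarkeDeriv φ (x + τ • d) ((s - τ) • d) := by
    refine hφ.le_clarkeDeriv (p := fun r => x + (τ - r * (s - τ)) • d) ?_ ?_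
    · have : Tendsto (fun r : ℝ => x + (τ - r * (s - τ)) • d) (nhdsWithin 0 (Ioi 0))
          (nhds (x + (τ - 0) • d)) :=
        ((hlim.const_sub τ).smul_const d).const_add x
      rwa [sub_zero] at this
    · filter_upwards [hlim.eventually_lt_const hτ.1, self_mem_nhdsWithin] with r hr hr0
      have hr0' : 0 < r * (s - τ) := mul_pos hr0 hσ
      have hm := hmax (τ - r * (s - τ)) ⟨by linarith, by linarith [hτ.2]⟩
      have he : x + (τ - r * (s - τ)) • d + r • (s - τ) • d = x + τ • d := by module
      rw [he]
      simp only [G] at hm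
      linarith
  have h₂ : -α * (s - τ) ≤ clarkeDeriv φ (x + s • d) (-((s - τ) • d)) := by
    refine hφ.le_clarkeDeriv (p := fun _ => x + s • d) tendsto_const_nhds ?_
    filter_upwards [hlim.eventually_lt_const hσ, self_mem_nhdsWithin] with r hr hr0
    have hr0' : 0 < r * (s - τ) := mul_pos hr0 hσ
    have hm := hmin (s - r * (s - τ)) ⟨by linarith, by linarith [hs.2]⟩
    have he : x + s • d + r • -((s - τ) • d) = x + (s - r * (s - τ)) • d := by module
    rw [he]
    simp only [G] at hm
    linarith
  have hdiff : x + s • d - (x + τ • d) = (s - τ) • d := by module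
  have hne : x + τ • d ≠ x + s • d := fun heq => by
    rw [heq, sub_self] at hdiff
    exact smul_ne_zero hσ.ne' hd hdiff.symm
  have h₃ := h _ _ hne
  rw [← neg_sub (x + s • d), hdiff] at h₃
  linarith

theorem tendsto_quotient_half_quadratic_add_linear {V : Type*} [NormedAddCommGroup V]
    [NormedSpace ℝ V] (A : V →L[ℝ] V →L[ℝ] ℝ) (hA : ∀ u v : V, A u v = A v u)
    (b : V →L[ℝ] ℝ) (w d : V) :
    Tendsto (fun p : V × ℝ => (((1 / 2) * A (p.1 + p.2 • d) (p.1 + p.2 • d) + b (p.1 + p.2 • d)) -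
        ((1 / 2) * A p.1 p.1 + b p.1)) / p.2)
      (nhds w ×ˢ nhdsWithin 0 (Ioi 0)) (nhds (A w d + b d)) := by
  have h : Tendsto (fun p : V × ℝ => A p.1 d + (1 / 2) * p.2 * A d d + b d)
      (nhds (w, (0 : ℝ))) (nhds (A w d + (1 / 2) * 0 * A d d + b d)) :=
    Continuous.tendsto (f := fun p : V × ℝ => A p.1 d + (1 / 2) * p.2 * A d d + b d)
      (by fun_prop) (w, 0)
  rw [mul_zero, zero_mul, add_zero, nhds_prod_eq] at h
  refine (h.mono_left (prod_mono le_rfl nhdsWithin_le_nhds)).congr' ?_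
  filter_upwards [eventually_snd_pos w] with p hp
  simp only [map_add, map_smul, add_apply, smul_apply,
    smul_eq_mul, hA d p.1]
  field_simp
  ring

theorem locallyLipschitz_Lfun {V X : Type*} [NormedAddCommGroup V] [NormedSpace ℝ V]
    [NormedAddCommGroup X] [NormedSpace ℝ X] (γ : V →L[ℝ] X) (A : V →L[ℝ] V →L[ℝ] ℝ)
    (B : V → V →L[ℝ] ℝ) {J : X → X → ℝ} (hJ : ∀ w : X, LocallyLipschitz (J w)) (z : V)
    (g : V →L[ℝ] ℝ) : LocallyLipschitz (Lfun γ A B J z g) := by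
  have hq : ContDiff ℝ 1 fun w : V => (1 / 2) * A w w + (B z - g) w := by fun_prop
  exact hq.locallyLipschitz.add ((hJ (γ z)).comp γ.lipschitz.locallyLipschitz)

theorem clarkeDeriv_Lfun_le {V X : Type*} [NormedAddCommGroup V] [NormedSpace ℝ V]
    [NormedAddCommGroup X] [NormedSpace ℝ X] (γ : V →L[ℝ] X) (A : V →L[ℝ] V →L[ℝ] ℝ)
    (hA : ∀ u v : V, A u v = A v u) (B : V → V →L[ℝ] ℝ) {J : X → X → ℝ}
    (hJ : ∀ w : X, LocallyLipschitz (J w)) (z : V) (g : V →L[ℝ] ℝ) (w d : V) :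
    clarkeDeriv (Lfun γ A B J z g) w d ≤
      A w d + (B z - g) d + clarkeDeriv (J (γ z)) (γ w) (γ d) :=
  clarkeDeriv_add_comp_le (hJ (γ z)) γ (locallyLipschitz_Lfun γ A B hJ z g)
    (tendsto_quotient_half_quadratic_add_linear A hA (B z - g) w d)

/-- `∂L` is strongly monotone with constant `m_A − m_{J1} c_γ²`,
and consequently `L` is strictly convex. -/
theorem Lfun_strongly_monotone_subdiff_and_strictConvex
    {V X : Type*}
    [NormedAddCommGroup V] [NormedSpace ℝ V] [CompleteSpace V]
    [NormedAddCommGroup X] [NormedSpace ℝ X] [CompleteSpace X]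
    -- V reflexive
    (hrefl : Function.Surjective (NormedSpace.inclusionInDoubleDual ℝ V))
    (γ : V →L[ℝ] X)
    -- H(A)
    (A : V →L[ℝ] V →L[ℝ] ℝ)
    (hAsym : ∀ u v : V, A u v = A v u)
    (mA : ℝ) (hmA : 0 < mA)
    (hAco : ∀ u : V, mA * ‖u‖ ^ 2 ≤ A u u)
    -- H(B)
    (B : V → V →L[ℝ] ℝ)
    (LB : ℝ) (hLB : 0 < LB)
    (hB : ∀ v w : V, ‖B v - B w‖ ≤ LB * ‖v - w‖)
    -- H(J)
    (J : X → X → ℝ)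
    (hJa : ∀ w : X, LocallyLipschitz (J w))
    (c₀ c₁ c₂ : ℝ) (hc₀ : 0 ≤ c₀) (hc₁ : 0 ≤ c₁) (hc₂ : 0 ≤ c₂)
    (hJb : ∀ w v : X, ∀ ξ ∈ clarkeSubdiff (J w) v, ‖ξ‖ ≤ c₀ + c₁ * ‖w‖ + c₂ * ‖v‖)
    (mJ1 mJ2 : ℝ) (hmJ1 : 0 ≤ mJ1) (hmJ2 : 0 ≤ mJ2)
    (hJc : ∀ w₁ w₂ v₁ v₂ : X,
      clarkeDeriv (J w₁) v₁ (v₂ - v₁) + clarkeDeriv (J w₂) v₂ (v₁ - v₂) ≤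
        mJ1 * ‖v₁ - v₂‖ ^ 2 + mJ2 * ‖w₁ - w₂‖ * ‖v₁ - v₂‖)
    -- H(f)
    (T : ℝ) (hT : 0 < T)
    (f : ℝ → V →L[ℝ] ℝ) (hf : ContinuousOn f (Set.Icc 0 T))
    -- H(u₀)
    (u₀ : V)
    -- (H_s)
    (hs : 0 < mA - 2 * mJ1 * ‖γ‖ ^ 2)
    (z : V) (g : V →L[ℝ] ℝ) :
    (∀ w₁ w₂ : V, ∀ η₁ ∈ clarkeSubdiff (Lfun γ A B J z g) w₁,
      ∀ η₂ ∈ clarkeSubdiff (Lfun γ A B J z g) w₂,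
        (mA - mJ1 * ‖γ‖ ^ 2) * ‖w₁ - w₂‖ ^ 2 ≤ (η₁ - η₂) (w₁ - w₂)) ∧
    StrictConvexOn ℝ Set.univ (Lfun γ A B J z g) := by
  have key : ∀ w₁ w₂ : V, clarkeDeriv (Lfun γ A B J z g) w₁ (w₂ - w₁) +
      clarkeDeriv (Lfun γ A B J z g) w₂ (w₁ - w₂) ≤
        -((mA - mJ1 * ‖γ‖ ^ 2) * ‖w₁ - w₂‖ ^ 2) := by
    intro w₁ w₂
    have h₁ := clarkeDeriv_Lfun_le γ A hAsym B hJa z g w₁ (w₂ - w₁)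
    have h₂ := clarkeDeriv_Lfun_le γ A hAsym B hJa z g w₂ (w₁ - w₂)
    have h₃ := hJc (γ z) (γ z) (γ w₁) (γ w₂)
    rw [sub_self, norm_zero, mul_zero, zero_mul, add_zero, ← map_sub, ← map_sub] at h₃
    have h₄ : ‖γ (w₁ - w₂)‖ ^ 2 ≤ ‖γ‖ ^ 2 * ‖w₁ - w₂‖ ^ 2 := by
      rw [← mul_pow]
      gcongr
      exact γ.le_opNorm _
    have h₅ := mul_le_mul_of_nonneg_left h₄ hmJ1
    have h₆ := hAco (w₁ - w₂)
    have h₇ : A w₁ (w₂ - w₁) + A w₂ (w₁ - w₂) = -A (w₁ - w₂) (w₁ - w₂) := by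
      simp only [map_sub, sub_apply]
      ring
    have h₈ : (B z - g) (w₂ - w₁) + (B z - g) (w₁ - w₂) = 0 := by
      rw [← map_add, sub_add_sub_cancel, sub_self, map_zero]
    linarith
  refine ⟨fun w₁ w₂ η₁ hη₁ η₂ hη₂ => ?_,
    strictConvexOn_of_clarkeDeriv_add_neg (locallyLipschitz_Lfun γ A B hJa z g)
      fun x y hxy => (key x y).trans_lt (neg_lt_zero.2 (mul_pos ?_ ?_))⟩
  · have h₁ := hη₁ (w₂ - w₁)
    have h₂ := hη₂ (w₁ - w₂)
    have h₃ := key w₁ w₂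
    rw [← neg_sub w₁ w₂, map_neg, neg_sub] at h₁
    rw [sub_apply]
    linarith
  · linarith [mul_nonneg hmJ1 (sq_nonneg ‖γ‖)]
  · exact pow_pos (norm_pos_iff.2 (sub_ne_zero.2 hxy)) 2
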